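/- arXiv:2605.09957 — 2 statements merged into one kernel-verified Lean document; each statement's English description precedes it below -/
import Mathlib

section
/- For every d ≥ 1, the expected three-way collision probability of a uniformly random state on the complex unit sphere satisfies E_{ψ∼σ}[q_ψ] = ∫ q_ψ dσ(ψ) = 6/((d+1)(d+2)). -/
open MeasureTheory

noncomputable section

/-- The unit sphere of `ℂ^d`. -/
abbrev unitSphere (d : ℕ) : Type := Metric.sphere (0 : EuclideanSpace ℂ (Fin d)) 1

/-- The action of a (complex-linear) isometric equivalence of `ℂ^d` on the unit sphere. -/
def sphereMap (d : ℕ) (U : EuclideanSpace ℂ (Fin d) ≃ₗᵢ[ℂ] EuclideanSpace ℂ (Fin d))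
    (ψ : unitSphere d) : unitSphere d :=
  ⟨U ψ.1, by
    have hψ : ‖(ψ : EuclideanSpace ℂ (Fin d))‖ = 1 := by
      simpa [mem_sphere_iff_norm] using ψ.2

    simp [mem_sphere_iff_norm, U.norm_map, hψ]⟩

instance (d : ℕ) : MeasurableSpace (EuclideanSpace ℂ (Fin d)) := borel _
instance (d : ℕ) : BorelSpace (EuclideanSpace ℂ (Fin d)) := ⟨rfl⟩

/-- `σ` is the rotation-invariant (uniform) probability measure on the unit sphere of `ℂ^d`. -/
def IsUniformSphereMeasure (d : ℕ) (σ : Measure (unitSphere d)) : Prop :=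
  IsProbabilityMeasure σ ∧
    ∀ U : EuclideanSpace ℂ (Fin d) ≃ₗᵢ[ℂ] EuclideanSpace ℂ (Fin d),
      σ.map (sphereMap d U) = σ

/-- The two-way collision probability `p_ψ = Σ_x |ψ_x|⁴`. -/
def pColl (d : ℕ) (ψ : unitSphere d) : ℝ :=
  ∑ x : Fin d, ‖(ψ : EuclideanSpace ℂ (Fin d)) x‖ ^ 4

/-- The three-way collision probability `q_ψ = Σ_x |ψ_x|⁶`. -/
def qColl (d : ℕ) (ψ : unitSphere d) : ℝ :=
  ∑ x : Fin d, ‖(ψ : EuclideanSpace ℂ (Fin d)) x‖ ^ 6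

theorem continuous_sphereMap (d : ℕ)
    (U : EuclideanSpace ℂ (Fin d) ≃ₗᵢ[ℂ] EuclideanSpace ℂ (Fin d)) :
    Continuous (sphereMap d U) :=
  (U.continuous.comp continuous_subtype_val).subtype_mk _

theorem Continuous.integrable_unitSphere {d : ℕ} {σ : Measure (unitSphere d)}
    [IsProbabilityMeasure σ] {f : unitSphere d → ℝ} (hf : Continuous f) : Integrable f σ :=
  hf.integrable_of_hasCompactSupport (HasCompactSupport.of_compactSpace f)

theorem sum_norm_sq_coord {d : ℕ} (ψ : unitSphere d) : ∑ x, ‖ψ.1 x‖ ^ 2 = 1 := by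
  rw [← EuclideanSpace.norm_sq_eq, norm_eq_of_mem_sphere ψ, one_pow]

/-- The moments of the squared overlap with a unit vector do not depend on the unit vector. -/
theorem integral_norm_inner_sq_pow {d : ℕ} {σ : Measure (unitSphere d)}
    (hσ : IsUniformSphereMeasure d σ) (i : Fin d) (u : EuclideanSpace ℂ (Fin d))
    (hu : ‖u‖ = 1) (n : ℕ) :
    ∫ ψ, (‖inner ℂ u ψ.1‖ ^ 2) ^ n ∂σ = ∫ ψ, (‖ψ.1 i‖ ^ 2) ^ n ∂σ := by
  obtain ⟨b, hb⟩ := Orthonormal.exists_orthonormalBasis_extension_of_card_eq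
    (𝕜 := ℂ) (E := EuclideanSpace ℂ (Fin d)) (ι := Fin d) (by simp) (v := fun _ => u) (s := {i})
    (by
      refine ⟨fun _ => hu, fun a c hac => ?_⟩
      exact absurd (Subsingleton.elim a c) hac)
  have hbi : b i = u := hb i rfl
  conv_rhs => rw [← hσ.2 b.repr]
  rw [integral_map (continuous_sphereMap d b.repr).aemeasurable
    (Continuous.aestronglyMeasurable (by fun_prop))]
  refine integral_congr_ae (Filter.Eventually.of_forall fun ψ => ?_)
  simp [sphereMap, OrthonormalBasis.repr_apply_apply, hbi]

theorem integral_norm_coord_sq_pow {d : ℕ} {σ : Measure (unitSphere d)}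
    (hσ : IsUniformSphereMeasure d σ) (i j : Fin d) (n : ℕ) :
    ∫ ψ, (‖ψ.1 j‖ ^ 2) ^ n ∂σ = ∫ ψ, (‖ψ.1 i‖ ^ 2) ^ n ∂σ := by
  rw [← integral_norm_inner_sq_pow hσ i (EuclideanSpace.single j 1) (by simp) n]
  simp [EuclideanSpace.inner_single_left]

theorem integral_norm_add_mul_sq_pow {d : ℕ} {σ : Measure (unitSphere d)}
    (hσ : IsUniformSphereMeasure d σ) (k : Fin d) {i j : Fin d} (hij : i ≠ j) {ω : ℂ}
    (hω : ‖ω‖ = 1) (n : ℕ) :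
    ∫ ψ, (‖ψ.1 i + ω * ψ.1 j‖ ^ 2) ^ n ∂σ = 2 ^ n * ∫ ψ, (‖ψ.1 k‖ ^ 2) ^ n ∂σ := by
  set v : EuclideanSpace ℂ (Fin d) :=
    EuclideanSpace.single i 1 + EuclideanSpace.single j (starRingEnd ℂ ω) with hv
  have hinner (ψ : unitSphere d) : inner ℂ v ψ.1 = ψ.1 i + ω * ψ.1 j := by
    simp [hv, EuclideanSpace.inner_single_left]
  have hnorm : ‖v‖ ^ 2 = 2 := by
    have horth : inner ℂ (EuclideanSpace.single i (1 : ℂ))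
        (EuclideanSpace.single j (starRingEnd ℂ ω)) = 0 := by
      simp [EuclideanSpace.inner_single_left, hij]
    have h := norm_add_sq_eq_norm_sq_add_norm_sq_of_inner_eq_zero _ _ horth
    rw [← hv] at h
    simp only [PiLp.norm_single, norm_one, RCLike.norm_conj, hω] at h
    linarith
  have hv0 : v ≠ 0 := by
    intro h
    simp [h] at hnorm
  have hunit : ‖((‖v‖ : ℂ)⁻¹) • v‖ = 1 := by
    simpa using norm_smul_inv_norm (𝕜 := ℂ) hv0
  rw [← integral_norm_inner_sq_pow hσ k _ hunit n, ← integral_const_mul]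
  refine integral_congr_ae (Filter.Eventually.of_forall fun ψ => ?_)
  simp only [inner_smul_left, hinner, norm_mul, RCLike.norm_conj, norm_inv, Complex.norm_real,
    norm_norm, mul_pow, inv_pow, hnorm]
  rw [mul_inv_cancel_left₀ (by positivity)]

theorem Complex.sum_norm_add_phase_pow_four (z w : ℂ) :
    (‖z + 1 * w‖ ^ 2) ^ 2 + (‖z + -1 * w‖ ^ 2) ^ 2 + (‖z + I * w‖ ^ 2) ^ 2
      + (‖z + -I * w‖ ^ 2) ^ 2
      = 4 * (‖z‖ ^ 2) ^ 2 + 4 * (‖w‖ ^ 2) ^ 2 + 16 * (‖z‖ ^ 2 * ‖w‖ ^ 2) := by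
  simp only [Complex.sq_norm, Complex.normSq_apply]
  simp
  ring

theorem Complex.sum_norm_add_phase_pow_six (z w : ℂ) :
    (‖z + 1 * w‖ ^ 2) ^ 3 + (‖z + -1 * w‖ ^ 2) ^ 3 + (‖z + I * w‖ ^ 2) ^ 3
      + (‖z + -I * w‖ ^ 2) ^ 3
      = 4 * (‖z‖ ^ 2) ^ 3 + 4 * (‖w‖ ^ 2) ^ 3
        + 36 * ((‖z‖ ^ 2) ^ 2 * ‖w‖ ^ 2 + (‖w‖ ^ 2) ^ 2 * ‖z‖ ^ 2) := by
  simp only [Complex.sq_norm, Complex.normSq_apply]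
  simp
  ring

theorem integral_sum_norm_add_phase {d : ℕ} {σ : Measure (unitSphere d)}
    (hσ : IsUniformSphereMeasure d σ) (k : Fin d) {i j : Fin d} (hij : i ≠ j) (n : ℕ) :
    ∫ ψ, ((‖ψ.1 i + 1 * ψ.1 j‖ ^ 2) ^ n + (‖ψ.1 i + -1 * ψ.1 j‖ ^ 2) ^ n
      + (‖ψ.1 i + Complex.I * ψ.1 j‖ ^ 2) ^ n + (‖ψ.1 i + -Complex.I * ψ.1 j‖ ^ 2) ^ n) ∂σ
      = 4 * 2 ^ n * ∫ ψ, (‖ψ.1 k‖ ^ 2) ^ n ∂σ := by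
  have := hσ.1
  rw [integral_add, integral_add, integral_add,
    integral_norm_add_mul_sq_pow hσ k hij (by simp), integral_norm_add_mul_sq_pow hσ k hij (by simp),
    integral_norm_add_mul_sq_pow hσ k hij (by simp), integral_norm_add_mul_sq_pow hσ k hij (by simp)]
  · ring
  all_goals exact Continuous.integrable_unitSphere (by fun_prop)

theorem integral_norm_coord_sq_mul {d : ℕ} {σ : Measure (unitSphere d)}
    (hσ : IsUniformSphereMeasure d σ) (k : Fin d) {i j : Fin d} (hij : i ≠ j) :
    ∫ ψ, ‖ψ.1 i‖ ^ 2 * ‖ψ.1 j‖ ^ 2 ∂σ = (∫ ψ, (‖ψ.1 k‖ ^ 2) ^ 2 ∂σ) / 2 := by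
  have := hσ.1
  have h := integral_sum_norm_add_phase hσ k hij 2
  simp only [Complex.sum_norm_add_phase_pow_four] at h
  rw [integral_add, integral_add, integral_const_mul, integral_const_mul, integral_const_mul,
    integral_norm_coord_sq_pow hσ k i, integral_norm_coord_sq_pow hσ k j] at h
  · linarith
  all_goals exact Continuous.integrable_unitSphere (by fun_prop)

theorem integral_norm_coord_pow_four_mul_add {d : ℕ} {σ : Measure (unitSphere d)}
    (hσ : IsUniformSphereMeasure d σ) (k : Fin d) {i j : Fin d} (hij : i ≠ j) :
    ∫ ψ, (‖ψ.1 i‖ ^ 2) ^ 2 * ‖ψ.1 j‖ ^ 2 ∂σ + ∫ ψ, (‖ψ.1 j‖ ^ 2) ^ 2 * ‖ψ.1 i‖ ^ 2 ∂σ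
      = 2 * (∫ ψ, (‖ψ.1 k‖ ^ 2) ^ 3 ∂σ) / 3 := by
  have := hσ.1
  have h := integral_sum_norm_add_phase hσ k hij 3
  simp only [Complex.sum_norm_add_phase_pow_six] at h
  rw [integral_add, integral_add, integral_const_mul, integral_const_mul, integral_const_mul,
    integral_norm_coord_sq_pow hσ k i, integral_norm_coord_sq_pow hσ k j, integral_add] at h
  · linarith
  all_goals exact Continuous.integrable_unitSphere (by fun_prop)

theorem sum_integral_mul_norm_coord_sq {d : ℕ} {σ : Measure (unitSphere d)}
    (hσ : IsUniformSphereMeasure d σ) {f : unitSphere d → ℝ} (hf : Continuous f) :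
    ∑ j, ∫ ψ, f ψ * ‖ψ.1 j‖ ^ 2 ∂σ = ∫ ψ, f ψ ∂σ := by
  have := hσ.1
  rw [← integral_finsetSum _ fun j _ => Continuous.integrable_unitSphere (by fun_prop)]
  simp [← Finset.mul_sum, sum_norm_sq_coord]

/-- The first moment of `‖ψ_k‖²` in terms of the second. -/
theorem integral_norm_coord_sq {d : ℕ} {σ : Measure (unitSphere d)}
    (hσ : IsUniformSphereMeasure d σ) (k : Fin d) :
    ∫ ψ, ‖ψ.1 k‖ ^ 2 ∂σ = (d + 1) / 2 * ∫ ψ, (‖ψ.1 k‖ ^ 2) ^ 2 ∂σ := by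
  have hterm (j : Fin d) : ∫ ψ, ‖ψ.1 k‖ ^ 2 * ‖ψ.1 j‖ ^ 2 ∂σ
      = (∫ ψ, (‖ψ.1 k‖ ^ 2) ^ 2 ∂σ) / 2
        + if k = j then (∫ ψ, (‖ψ.1 k‖ ^ 2) ^ 2 ∂σ) / 2 else 0 := by
    split_ifs with h
    · subst h
      simp only [← sq]
      ring
    · rw [integral_norm_coord_sq_mul hσ k h, add_zero]
  rw [← sum_integral_mul_norm_coord_sq hσ (by fun_prop), Finset.sum_congr rfl fun j _ => hterm j,
    Finset.sum_add_distrib]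
  simp
  ring

/-- The second moment of `‖ψ_k‖²` in terms of the third. -/
theorem integral_norm_coord_sq_sq {d : ℕ} {σ : Measure (unitSphere d)}
    (hσ : IsUniformSphereMeasure d σ) (k : Fin d) :
    ∫ ψ, (‖ψ.1 k‖ ^ 2) ^ 2 ∂σ = (d + 2) / 3 * ∫ ψ, (‖ψ.1 k‖ ^ 2) ^ 3 ∂σ := by
  set M := ∫ ψ, (‖ψ.1 k‖ ^ 2) ^ 3 ∂σ with hM
  let A (i j : Fin d) : ℝ := ∫ ψ, (‖ψ.1 i‖ ^ 2) ^ 2 * ‖ψ.1 j‖ ^ 2 ∂σ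
  have hterm (i j : Fin d) : A i j + A j i = 2 * M / 3 + if i = j then 4 * M / 3 else 0 := by
    split_ifs with h
    · subst h
      have hA : A i i = M := by
        rw [hM, ← integral_norm_coord_sq_pow hσ k i]
        simp only [A, ← pow_succ]
      rw [hA]
      ring
    · rw [add_zero]
      exact integral_norm_coord_pow_four_mul_add hσ k h
  have hrow (i : Fin d) : ∑ j, A i j = ∫ ψ, (‖ψ.1 k‖ ^ 2) ^ 2 ∂σ := by
    rw [← integral_norm_coord_sq_pow hσ k i]
    exact sum_integral_mul_norm_coord_sq hσ (by fun_prop)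
  have hsum : ∑ i, ∑ j, (A i j + A j i) = 2 * (d * ∫ ψ, (‖ψ.1 k‖ ^ 2) ^ 2 ∂σ) := by
    simp only [Finset.sum_add_distrib]
    rw [Finset.sum_comm (f := fun i j => A j i)]
    simp only [hrow]
    simp
    ring
  simp only [hterm, Finset.sum_add_distrib, Finset.sum_ite_eq, Finset.sum_const, Finset.mem_univ,
    if_true, Finset.card_univ, Fintype.card_fin, nsmul_eq_mul] at hsum
  have hd : (d : ℝ) ≠ 0 := Nat.cast_ne_zero.mpr (Fin.pos k).ne'
  apply mul_left_cancel₀ hd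
  linarith

/-- The expected three-way collision probability of a uniformly random state on the unit sphere of
`ℂ^d` is `6/((d+1)(d+2))`. -/
theorem expectation_qColl (d : ℕ) (hd : 1 ≤ d) (σ : Measure (unitSphere d))
    (hσ : IsUniformSphereMeasure d σ) :
    ∫ ψ, qColl d ψ ∂σ = 6 / (((d : ℝ) + 1) * ((d : ℝ) + 2)) := by
  have := hσ.1
  let k : Fin d := ⟨0, hd⟩
  have hq : ∫ ψ, qColl d ψ ∂σ = d * ∫ ψ, (‖ψ.1 k‖ ^ 2) ^ 3 ∂σ := by
    have hpow (a : ℝ) : a ^ 6 = (a ^ 2) ^ 3 := by ring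
    simp only [qColl, hpow]
    rw [integral_finsetSum _ fun j _ => Continuous.integrable_unitSphere (by fun_prop)]
    simp [integral_norm_coord_sq_pow hσ k]
  have hfirst : d * ∫ ψ, ‖ψ.1 k‖ ^ 2 ∂σ = 1 := by
    have h := sum_integral_mul_norm_coord_sq hσ (f := fun _ => 1) continuous_const
    have hcoord (j : Fin d) : ∫ ψ, ‖ψ.1 j‖ ^ 2 ∂σ = ∫ ψ, ‖ψ.1 k‖ ^ 2 ∂σ := by
      simpa using integral_norm_coord_sq_pow hσ k j 1
    simpa [hcoord] using h
  rw [integral_norm_coord_sq hσ, integral_norm_coord_sq_sq hσ] at hfirst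
  rw [hq, eq_div_iff (by positivity)]
  linarith
end
end

section
/- For every d ≥ 1, the second moment of the two-way collision probability of a uniformly random state on the complex unit sphere satisfies E_{ψ∼σ}[p_ψ²] = ∫ p_ψ² dσ(ψ) = (24 + 4(d−1))/((d+3)(d+2)(d+1)). -/
open MeasureTheory

noncomputable section

open ComplexConjugate

/-- The unitary map of `ℂ^d` acting on the coordinates `x`, `y` by the `SU(2)` matrix with first
row `(α, β)` and fixing the other coordinates, as a linear map. -/
def planeRotationLinear {d : ℕ} (x y : Fin d) (α β : ℂ) :
    EuclideanSpace ℂ (Fin d) →ₗ[ℂ] EuclideanSpace ℂ (Fin d) where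
  toFun ψ := WithLp.toLp 2 fun i =>
    if i = x then α * ψ x + β * ψ y else if i = y then -conj β * ψ x + conj α * ψ y else ψ i
  map_add' φ ψ := by
    ext i
    simp only [PiLp.add_apply]
    split_ifs <;> ring
  map_smul' c ψ := by
    ext i
    simp only [PiLp.smul_apply, smul_eq_mul, RingHom.id_apply]
    split_ifs <;> ring

lemma normSq_add_normSq_of_su2 {α β : ℂ} (h : Complex.normSq α + Complex.normSq β = 1) (a b : ℂ) :
    Complex.normSq (α * a + β * b) + Complex.normSq (-conj β * a + conj α * b)
      = Complex.normSq a + Complex.normSq b := by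
  simp only [Complex.normSq_apply, Complex.add_re, Complex.add_im, Complex.mul_re, Complex.mul_im,
    Complex.neg_re, Complex.neg_im, Complex.conj_re, Complex.conj_im] at h ⊢
  linear_combination (a.re * a.re + a.im * a.im + b.re * b.re + b.im * b.im) * h

lemma norm_planeRotationLinear {d : ℕ} {x y : Fin d} (hxy : x ≠ y) {α β : ℂ}
    (h : Complex.normSq α + Complex.normSq β = 1) (ψ : EuclideanSpace ℂ (Fin d)) :
    ‖planeRotationLinear x y α β ψ‖ = ‖ψ‖ := by
  have key := normSq_add_normSq_of_su2 h (ψ x) (ψ y)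
  rw [EuclideanSpace.norm_eq, EuclideanSpace.norm_eq]
  congr 1
  simp only [← Complex.normSq_eq_norm_sq]
  have hterm : ∀ i, Complex.normSq (planeRotationLinear x y α β ψ i) = Complex.normSq (ψ i)
      + ((if i = x then Complex.normSq (α * ψ x + β * ψ y) - Complex.normSq (ψ x) else 0)
      - (if i = y then Complex.normSq (α * ψ x + β * ψ y) - Complex.normSq (ψ x) else 0)) := by
    intro i
    simp only [planeRotationLinear, LinearMap.coe_mk, AddHom.coe_mk]
    by_cases hx : i = x
    · subst hx
      simp [hxy]
    · by_cases hy : i = y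
      · subst hy
        simp only [hx, if_true, if_false]
        linarith
      · simp [hx, hy]
  simp [hterm, Finset.sum_add_distrib]

/-- The unitary map of `ℂ^d` acting on the coordinates `x`, `y` by the `SU(2)` matrix with first
row `(α, β)` and fixing the other coordinates. -/
def planeRotation {d : ℕ} {x y : Fin d} (hxy : x ≠ y) {α β : ℂ}
    (h : Complex.normSq α + Complex.normSq β = 1) :
    EuclideanSpace ℂ (Fin d) ≃ₗᵢ[ℂ] EuclideanSpace ℂ (Fin d) :=
  LinearIsometry.toLinearIsometryEquiv
    ⟨planeRotationLinear x y α β, norm_planeRotationLinear hxy h⟩ rfl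

lemma planeRotation_apply_left {d : ℕ} {x y : Fin d} (hxy : x ≠ y) {α β : ℂ}
    (h : Complex.normSq α + Complex.normSq β = 1) (ψ : EuclideanSpace ℂ (Fin d)) :
    planeRotation hxy h ψ x = α * ψ x + β * ψ y := by
  simp [planeRotation, planeRotationLinear]

lemma planeRotation_apply_right {d : ℕ} {x y : Fin d} (hxy : x ≠ y) {α β : ℂ}
    (h : Complex.normSq α + Complex.normSq β = 1) (ψ : EuclideanSpace ℂ (Fin d)) :
    planeRotation hxy h ψ y = -conj β * ψ x + conj α * ψ y := by
  simp [planeRotation, planeRotationLinear, hxy.symm]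

/-- The probability `|ψ_x|²` of the outcome `x`. -/
def outcomeProb {d : ℕ} (x : Fin d) (ψ : unitSphere d) : ℝ :=
  Complex.normSq ((ψ : EuclideanSpace ℂ (Fin d)) x)

@[fun_prop]
lemma continuous_coord {d : ℕ} (x : Fin d) :
    Continuous fun ψ : unitSphere d => (ψ : EuclideanSpace ℂ (Fin d)) x :=
  (EuclideanSpace.proj (𝕜 := ℂ) x).continuous.comp continuous_subtype_val

@[fun_prop]
lemma continuous_outcomeProb {d : ℕ} (x : Fin d) : Continuous (outcomeProb x) :=
  Complex.continuous_normSq.comp (continuous_coord x)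

lemma sum_outcomeProb {d : ℕ} (ψ : unitSphere d) : ∑ x, outcomeProb x ψ = 1 := by
  have h : ‖(ψ : EuclideanSpace ℂ (Fin d))‖ = 1 := by simp
  simp only [outcomeProb, Complex.normSq_eq_norm_sq]
  rw [← EuclideanSpace.norm_sq_eq, h, one_pow]

lemma integrable_of_continuous {d : ℕ} (σ : Measure (unitSphere d)) [IsFiniteMeasure σ]
    {f : unitSphere d → ℝ} (hf : Continuous f) : Integrable f σ :=
  hf.integrable_of_hasCompactSupport (HasCompactSupport.of_compactSpace f)

section Invariance

variable {d : ℕ} {σ : Measure (unitSphere d)}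

lemma IsUniformSphereMeasure.integral_comp (hσ : IsUniformSphereMeasure d σ)
    (U : EuclideanSpace ℂ (Fin d) ≃ₗᵢ[ℂ] EuclideanSpace ℂ (Fin d)) {f : unitSphere d → ℝ}
    (hf : Continuous f) : ∫ ψ, f (sphereMap d U ψ) ∂σ = ∫ ψ, f ψ ∂σ := by
  have hU : Continuous (sphereMap d U) :=
    (U.continuous.comp continuous_subtype_val).subtype_mk _
  conv_rhs => rw [← hσ.2 U]
  exact (integral_map hU.measurable.aemeasurable hf.aestronglyMeasurable).symm

lemma IsUniformSphereMeasure.integral_su2 (hσ : IsUniformSphereMeasure d σ) {x y : Fin d}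
    (hxy : x ≠ y) {α β : ℂ} (h : Complex.normSq α + Complex.normSq β = 1) {f : ℝ → ℝ → ℝ}
    (hf : Continuous fun z : ℝ × ℝ => f z.1 z.2) :
    ∫ ψ : unitSphere d, f (Complex.normSq (α * ψ.1 x + β * ψ.1 y))
        (Complex.normSq (-conj β * ψ.1 x + conj α * ψ.1 y)) ∂σ
      = ∫ ψ, f (outcomeProb x ψ) (outcomeProb y ψ) ∂σ := by
  have hc : Continuous fun ψ => f (outcomeProb x ψ) (outcomeProb y ψ) :=
    hf.comp ((continuous_outcomeProb x).prodMk (continuous_outcomeProb y))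
  rw [← hσ.integral_comp (planeRotation hxy h) hc]
  simp only [outcomeProb, sphereMap, planeRotation_apply_left, planeRotation_apply_right]

lemma IsUniformSphereMeasure.integral_swap (hσ : IsUniformSphereMeasure d σ) {x y : Fin d}
    (hxy : x ≠ y) {f : ℝ → ℝ → ℝ} (hf : Continuous fun z : ℝ × ℝ => f z.1 z.2) :
    ∫ ψ, f (outcomeProb y ψ) (outcomeProb x ψ) ∂σ
      = ∫ ψ, f (outcomeProb x ψ) (outcomeProb y ψ) ∂σ := by
  rw [← hσ.integral_su2 hxy (α := 0) (β := 1) (by simp) hf]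
  simp [outcomeProb]

/-- The real part of `ψ_x * conj ψ_y`. -/
def coherenceRe (x y : Fin d) (ψ : unitSphere d) : ℝ :=
  (ψ.1 x).re * (ψ.1 y).re + (ψ.1 x).im * (ψ.1 y).im

/-- The imaginary part of `ψ_x * conj ψ_y`. -/
def coherenceIm (x y : Fin d) (ψ : unitSphere d) : ℝ :=
  (ψ.1 x).im * (ψ.1 y).re - (ψ.1 x).re * (ψ.1 y).im

@[fun_prop]
lemma continuous_coherenceRe (x y : Fin d) : Continuous (coherenceRe x y) := by
  unfold coherenceRe
  fun_prop

@[fun_prop]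
lemma continuous_coherenceIm (x y : Fin d) : Continuous (coherenceIm x y) := by
  unfold coherenceIm
  fun_prop

lemma coherenceRe_sq_add_coherenceIm_sq (x y : Fin d) (ψ : unitSphere d) :
    coherenceRe x y ψ ^ 2 + coherenceIm x y ψ ^ 2 = outcomeProb x ψ * outcomeProb y ψ := by
  simp only [coherenceRe, coherenceIm, outcomeProb, Complex.normSq_apply]
  ring

/-- Invariance under the balanced beam splitter with relative phase `u + i v`. -/
lemma IsUniformSphereMeasure.integral_beamSplitter (hσ : IsUniformSphereMeasure d σ)
    {x y : Fin d} (hxy : x ≠ y) {u v : ℝ} (huv : u ^ 2 + v ^ 2 = 1) {f : ℝ → ℝ → ℝ}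
    (hf : Continuous fun z : ℝ × ℝ => f z.1 z.2) :
    ∫ ψ, f ((outcomeProb x ψ + outcomeProb y ψ) / 2
            + (u * coherenceRe x y ψ + v * coherenceIm x y ψ))
          ((outcomeProb x ψ + outcomeProb y ψ) / 2
            - (u * coherenceRe x y ψ + v * coherenceIm x y ψ)) ∂σ
      = ∫ ψ, f (outcomeProb x ψ) (outcomeProb y ψ) ∂σ := by
  obtain ⟨c, hc⟩ : ∃ c : ℝ, c ^ 2 = 1 / 2 := ⟨√(1 / 2), Real.sq_sqrt (by norm_num)⟩
  have h : Complex.normSq (c : ℂ) + Complex.normSq (⟨c * u, c * v⟩ : ℂ) = 1 := by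
    simp only [Complex.normSq_apply, Complex.ofReal_re, Complex.ofReal_im]
    linear_combination c ^ 2 * huv + 2 * hc
  rw [← hσ.integral_su2 hxy h hf]
  refine integral_congr_ae (.of_forall fun ψ => ?_)
  simp only
  congr 1
  all_goals
    simp only [outcomeProb, coherenceRe, coherenceIm, Complex.normSq_apply, Complex.add_re,
      Complex.add_im, Complex.mul_re, Complex.mul_im, Complex.neg_re, Complex.neg_im,
      Complex.conj_re, Complex.conj_im, Complex.ofReal_re, Complex.ofReal_im]
    generalize (ψ.1 x).re = a
    generalize (ψ.1 x).im = a'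
    generalize (ψ.1 y).re = b
    generalize (ψ.1 y).im = b'
  · linear_combination -(c ^ 2 * (b ^ 2 + b' ^ 2)) * huv
      - (a ^ 2 + a' ^ 2 + b ^ 2 + b' ^ 2 + 2 * u * (a * b + a' * b')
        + 2 * v * (a' * b - a * b')) * hc
  · linear_combination -(c ^ 2 * (a ^ 2 + a' ^ 2)) * huv
      - (a ^ 2 + a' ^ 2 + b ^ 2 + b' ^ 2 - 2 * u * (a * b + a' * b')
        - 2 * v * (a' * b - a * b')) * hc

/-- If the average of `f` over the eight balanced beam splitters whose phases are eighth roots of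
unity is `g`, then `f` and `g` have the same expectation. -/
lemma IsUniformSphereMeasure.integral_eq_of_average (hσ : IsUniformSphereMeasure d σ)
    {x y : Fin d} (hxy : x ≠ y) {f g : ℝ → ℝ → ℝ}
    (hf : Continuous fun z : ℝ × ℝ => f z.1 z.2)
    (hfg : ∀ p q r s t w : ℝ, r ^ 2 + s ^ 2 = p * q → t ^ 2 = (r + s) ^ 2 / 2 →
      w ^ 2 = (r - s) ^ 2 / 2 →
      f ((p + q) / 2 + r) ((p + q) / 2 - r) + f ((p + q) / 2 - r) ((p + q) / 2 + r)
      + (f ((p + q) / 2 + s) ((p + q) / 2 - s) + f ((p + q) / 2 - s) ((p + q) / 2 + s))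
      + (f ((p + q) / 2 + t) ((p + q) / 2 - t) + f ((p + q) / 2 - t) ((p + q) / 2 + t))
      + (f ((p + q) / 2 + w) ((p + q) / 2 - w) + f ((p + q) / 2 - w) ((p + q) / 2 + w))
      = 8 * g p q) :
    ∫ ψ, f (outcomeProb x ψ) (outcomeProb y ψ) ∂σ
      = ∫ ψ, g (outcomeProb x ψ) (outcomeProb y ψ) ∂σ := by
  have := hσ.1
  obtain ⟨c, hc⟩ : ∃ c : ℝ, c ^ 2 = 1 / 2 := ⟨√(1 / 2), Real.sq_sqrt (by norm_num)⟩
  let F (u v : ℝ) (ψ : unitSphere d) : ℝ :=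
    f ((outcomeProb x ψ + outcomeProb y ψ) / 2
        + (u * coherenceRe x y ψ + v * coherenceIm x y ψ))
      ((outcomeProb x ψ + outcomeProb y ψ) / 2
        - (u * coherenceRe x y ψ + v * coherenceIm x y ψ))
  have hF (u v : ℝ) : Integrable (F u v) σ := by
    refine integrable_of_continuous σ (hf.comp (.prodMk ?_ ?_)) <;> fun_prop
  have hI (u v : ℝ) (huv : u ^ 2 + v ^ 2 = 1) :
      ∫ ψ, F u v ψ ∂σ = ∫ ψ, f (outcomeProb x ψ) (outcomeProb y ψ) ∂σ :=
    hσ.integral_beamSplitter hxy huv hf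
  have hsum : ∀ ψ, F 1 0 ψ + F (-1) 0 ψ + (F 0 1 ψ + F 0 (-1) ψ)
      + (F c c ψ + F (-c) (-c) ψ) + (F c (-c) ψ + F (-c) c ψ)
      = 8 * g (outcomeProb x ψ) (outcomeProb y ψ) := by
    intro ψ
    rw [← hfg _ _ _ _ (c * coherenceRe x y ψ + c * coherenceIm x y ψ)
      (c * coherenceRe x y ψ - c * coherenceIm x y ψ)
      (coherenceRe_sq_add_coherenceIm_sq x y ψ)
      (by linear_combination (coherenceRe x y ψ + coherenceIm x y ψ) ^ 2 * hc)
      (by linear_combination (coherenceRe x y ψ - coherenceIm x y ψ) ^ 2 * hc)]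
    simp only [F]
    ring_nf
  have hint := integral_congr_ae (μ := σ) (.of_forall hsum)
  rw [integral_const_mul, integral_add (by fun_prop) (by fun_prop),
    integral_add (by fun_prop) (by fun_prop), integral_add (by fun_prop) (by fun_prop),
    integral_add (hF _ _) (hF _ _), integral_add (hF _ _) (hF _ _),
    integral_add (hF _ _) (hF _ _), integral_add (hF _ _) (hF _ _),
    hI 1 0 (by norm_num), hI (-1) 0 (by norm_num), hI 0 1 (by norm_num), hI 0 (-1) (by norm_num),
    hI c c (by linarith), hI (-c) (-c) (by linarith [neg_sq c]), hI c (-c) (by linarith [neg_sq c]),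
    hI (-c) c (by linarith [neg_sq c])] at hint
  linarith

lemma IsUniformSphereMeasure.integral_pow_eq (hσ : IsUniformSphereMeasure d σ) (n : ℕ)
    (x y : Fin d) : ∫ ψ, outcomeProb x ψ ^ n ∂σ = ∫ ψ, outcomeProb y ψ ^ n ∂σ := by
  rcases eq_or_ne x y with rfl | hxy
  · rfl
  · exact (hσ.integral_swap hxy (f := fun p _ => p ^ n) (by fun_prop)).symm

lemma IsUniformSphereMeasure.integral_prob_mul_prob (hσ : IsUniformSphereMeasure d σ)
    {x y : Fin d} (hxy : x ≠ y) :
    ∫ ψ, outcomeProb x ψ * outcomeProb y ψ ∂σ = (∫ ψ, outcomeProb x ψ ^ 2 ∂σ) / 2 := by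
  have := hσ.1
  have h := hσ.integral_eq_of_average hxy (f := fun p _ => p ^ 2)
    (g := fun p q => 1 / 4 * p ^ 2 + 1 / 4 * q ^ 2 + p * q) (by fun_prop) (by
      intro p q r s t w h₁ h₂ h₃
      linear_combination 4 * h₁ + 2 * h₂ + 2 * h₃)
  have hi {f : unitSphere d → ℝ} (hf : Continuous f) := integrable_of_continuous σ hf
  rw [integral_add (hi (by fun_prop)) (hi (by fun_prop)),
    integral_add (hi (by fun_prop)) (hi (by fun_prop)), integral_const_mul, integral_const_mul,
    hσ.integral_pow_eq 2 y x] at h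
  linarith

lemma IsUniformSphereMeasure.integral_prob_sq_mul_prob (hσ : IsUniformSphereMeasure d σ)
    {x y : Fin d} (hxy : x ≠ y) :
    ∫ ψ, outcomeProb x ψ ^ 2 * outcomeProb y ψ ∂σ = (∫ ψ, outcomeProb x ψ ^ 3 ∂σ) / 3 := by
  have := hσ.1
  have h := hσ.integral_eq_of_average hxy (f := fun p _ => p ^ 3)
    (g := fun p q => 1 / 8 * p ^ 3 + 1 / 8 * q ^ 3 + 9 / 8 * (p ^ 2 * q) + 9 / 8 * (q ^ 2 * p))
    (by fun_prop) (by
      intro p q r s t w h₁ h₂ h₃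
      linear_combination 3 * (p + q) / 2 * (4 * h₁ + 2 * h₂ + 2 * h₃))
  have hs := hσ.integral_swap hxy (f := fun p q => p ^ 2 * q) (by fun_prop)
  have hi {f : unitSphere d → ℝ} (hf : Continuous f) := integrable_of_continuous σ hf
  rw [integral_add (hi (by fun_prop)) (hi (by fun_prop)),
    integral_add (hi (by fun_prop)) (hi (by fun_prop)),
    integral_add (hi (by fun_prop)) (hi (by fun_prop)), integral_const_mul, integral_const_mul,
    integral_const_mul, integral_const_mul, hσ.integral_pow_eq 3 y x] at h
  linarith

lemma IsUniformSphereMeasure.integral_prob_sq_mul_prob_sq (hσ : IsUniformSphereMeasure d σ)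
    {x y : Fin d} (hxy : x ≠ y) :
    ∫ ψ, outcomeProb x ψ ^ 2 * outcomeProb y ψ ^ 2 ∂σ = (∫ ψ, outcomeProb x ψ ^ 4 ∂σ) / 6 := by
  have := hσ.1
  have h := hσ.integral_eq_of_average hxy (f := fun p q => p ^ 2 * q ^ 2)
    (g := fun p q => 1 / 16 * p ^ 4 + 1 / 16 * q ^ 4 + 1 / 4 * (p ^ 2 * q ^ 2))
    (by fun_prop) (by
      intro p q r s t w h₁ h₂ h₃
      linear_combination -(p + q) ^ 2 * (2 * h₁ + h₂ + h₃)
        + 2 * (t ^ 2 + (r + s) ^ 2 / 2) * h₂ + 2 * (w ^ 2 + (r - s) ^ 2 / 2) * h₃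
        + 3 * (r ^ 2 + s ^ 2 + p * q) * h₁)
  have hi {f : unitSphere d → ℝ} (hf : Continuous f) := integrable_of_continuous σ hf
  rw [integral_add (hi (by fun_prop)) (hi (by fun_prop)),
    integral_add (hi (by fun_prop)) (hi (by fun_prop)), integral_const_mul, integral_const_mul,
    integral_const_mul, hσ.integral_pow_eq 4 y x] at h
  linarith

lemma IsUniformSphereMeasure.integral_prob_cube_mul_prob (hσ : IsUniformSphereMeasure d σ)
    {x y : Fin d} (hxy : x ≠ y) :
    ∫ ψ, outcomeProb x ψ ^ 3 * outcomeProb y ψ ∂σ = (∫ ψ, outcomeProb x ψ ^ 4 ∂σ) / 4 := by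
  have := hσ.1
  have h := hσ.integral_eq_of_average hxy (f := fun p _ => p ^ 4)
    (g := fun p q => 1 / 16 * p ^ 4 + 1 / 16 * q ^ 4 + 1 * (p ^ 3 * q) + 1 * (q ^ 3 * p)
      + 9 / 4 * (p ^ 2 * q ^ 2))
    (by fun_prop) (by
      intro p q r s t w h₁ h₂ h₃
      linear_combination 3 * (p + q) ^ 2 * (2 * h₁ + h₂ + h₃)
        + 2 * (t ^ 2 + (r + s) ^ 2 / 2) * h₂ + 2 * (w ^ 2 + (r - s) ^ 2 / 2) * h₃
        + 3 * (r ^ 2 + s ^ 2 + p * q) * h₁)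
  have hs := hσ.integral_swap hxy (f := fun p q => p ^ 3 * q) (by fun_prop)
  have hi {f : unitSphere d → ℝ} (hf : Continuous f) := integrable_of_continuous σ hf
  rw [integral_add (hi (by fun_prop)) (hi (by fun_prop)),
    integral_add (hi (by fun_prop)) (hi (by fun_prop)),
    integral_add (hi (by fun_prop)) (hi (by fun_prop)),
    integral_add (hi (by fun_prop)) (hi (by fun_prop)), integral_const_mul, integral_const_mul,
    integral_const_mul, integral_const_mul, integral_const_mul, hσ.integral_pow_eq 4 y x,
    hσ.integral_prob_sq_mul_prob_sq hxy] at h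
  linarith

lemma sum_eq_of_eq_off_diagonal (x : Fin d) {F : Fin d → ℝ} {c : ℝ}
    (h : ∀ y, x ≠ y → F y = c) : ∑ y, F y = F x + ((d : ℝ) - 1) * c := by
  have hF : ∀ y, F y = c + if y = x then F x - c else 0 := by
    intro y
    by_cases hy : y = x
    · simp [hy]
    · simp [hy, h y (Ne.symm hy)]
  rw [Finset.sum_congr rfl fun y _ => hF y]
  simp [Finset.sum_add_distrib]
  ring

lemma integral_pow_eq_sum [IsFiniteMeasure σ] (n : ℕ) (x : Fin d) :
    ∫ ψ, outcomeProb x ψ ^ n ∂σ = ∑ y, ∫ ψ, outcomeProb x ψ ^ n * outcomeProb y ψ ∂σ := by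
  rw [← integral_finsetSum _ fun y _ => integrable_of_continuous σ (by fun_prop)]
  simp only [← Finset.mul_sum, sum_outcomeProb, mul_one]

lemma IsUniformSphereMeasure.integral_prob_pow_four (hσ : IsUniformSphereMeasure d σ)
    (x : Fin d) : (d : ℝ) * (d + 1) * (d + 2) * (d + 3) * ∫ ψ, outcomeProb x ψ ^ 4 ∂σ = 24 := by
  have := hσ.1
  have h₀ : 1 = (d : ℝ) * ∫ ψ, outcomeProb x ψ ^ 1 ∂σ := by
    have h := integral_pow_eq_sum (σ := σ) 0 x
    have hc : ∀ y, ∫ ψ, outcomeProb y ψ ∂σ = ∫ ψ, outcomeProb x ψ ∂σ := fun y => by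
      simpa using hσ.integral_pow_eq 1 y x
    simpa [hc] using h
  have h₁ := integral_pow_eq_sum (σ := σ) 1 x
  have h₂ := integral_pow_eq_sum (σ := σ) 2 x
  have h₃ := integral_pow_eq_sum (σ := σ) 3 x
  rw [sum_eq_of_eq_off_diagonal x fun y hy => by
    simpa only [pow_one] using hσ.integral_prob_mul_prob hy] at h₁
  rw [sum_eq_of_eq_off_diagonal x fun y hy => hσ.integral_prob_sq_mul_prob hy] at h₂
  rw [sum_eq_of_eq_off_diagonal x fun y hy => hσ.integral_prob_cube_mul_prob hy] at h₃
  simp only [← pow_succ, Nat.reduceAdd] at h₁ h₂ h₃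
  linear_combination -24 * h₀ - 24 * d * h₁ - 12 * d * (d + 1) * h₂
    - 4 * d * (d + 1) * (d + 2) * h₃

end Invariance

/-- The second moment of the two-way collision probability of a uniformly random state on the unit
sphere of `ℂ^d` is `(24 + 4(d-1))/((d+3)(d+2)(d+1))`. -/
theorem second_moment_pColl (d : ℕ) (hd : 1 ≤ d) (σ : Measure (unitSphere d))
    (hσ : IsUniformSphereMeasure d σ) :
    ∫ ψ, (pColl d ψ) ^ 2 ∂σ
      = (24 + 4 * ((d : ℝ) - 1)) / (((d : ℝ) + 3) * ((d : ℝ) + 2) * ((d : ℝ) + 1)) := by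
  have := hσ.1
  have hp : ∀ ψ, pColl d ψ ^ 2 = ∑ x, ∑ y, outcomeProb x ψ ^ 2 * outcomeProb y ψ ^ 2 := by
    intro ψ
    rw [← Finset.sum_mul_sum, ← sq]
    simp only [pColl, outcomeProb, Complex.normSq_eq_norm_sq, ← pow_mul]
  have hd' : (0 : ℝ) < d := by exact_mod_cast hd
  have hfour : ∀ x : Fin d, ∫ ψ, outcomeProb x ψ ^ 4 ∂σ
      = 24 / ((d : ℝ) * (d + 1) * (d + 2) * (d + 3)) := fun x => by
    rw [eq_div_iff (by positivity), mul_comm]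
    exact hσ.integral_prob_pow_four x
  have hrow : ∀ x : Fin d, ∑ y, ∫ ψ, outcomeProb x ψ ^ 2 * outcomeProb y ψ ^ 2 ∂σ
      = ((d : ℝ) + 5) / 6 * (24 / ((d : ℝ) * (d + 1) * (d + 2) * (d + 3))) := fun x => by
    rw [sum_eq_of_eq_off_diagonal x fun y hy => hσ.integral_prob_sq_mul_prob_sq hy]
    simp only [← pow_add, Nat.reduceAdd, hfour]
    ring
  simp only [hp]
  rw [integral_finsetSum _ fun x _ => integrable_of_continuous σ (by fun_prop)]
  rw [Finset.sum_congr rfl fun x _ => (integral_finsetSum _ fun y _ =>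
    integrable_of_continuous σ (by fun_prop)).trans (hrow x)]
  simp only [Finset.sum_const, Finset.card_univ, Fintype.card_fin, nsmul_eq_mul]
  field_simp
  ring
end
end
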